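/- arXiv:2603.22203 — 2 statements merged into one kernel-verified Lean document; each statement's English description precedes it below -/
import Mathlib

section
/- Let s ≥ 1 be an integer and C₀ ≥ 1. There is a constant C, depending only on s and C₀, such that the following holds. Let N ≥ 1, let I ⊂ ℤ be an interval with |I| ≤ C₀·N, let f, g : ℤ → ℂ be supported on I with |f| ≤ 1 and |g| ≤ 1, and let w : ℤ → ℂ. Then ∑_{x ∈ ℤ} |(1/N)·∑_{n=1}^{N} f(x−n)·g(x+n)·w(n)|^{2^s} ≤ C · ‖w‖_{U^{s+2}([N])}^{2^s} · N. -/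
/-- The conjugation-difference operator `Δ_h f (x) = f(x) ⋅ conj (f (x+h))`. -/
noncomputable def gowersDiff (f : ℤ → ℂ) (h : ℤ) : ℤ → ℂ :=
  fun x => f x * (starRingEnd ℂ) (f (x + h))

/-- Iterated conjugation-difference `Δ_{h₁,…,h_s} f`. -/
noncomputable def gowersIterDiff : (s : ℕ) → (ℤ → ℂ) → (Fin s → ℤ) → (ℤ → ℂ)
  | 0, f, _ => f
  | (s + 1), f, h => gowersDiff (gowersIterDiff s f (fun i => h i.castSucc)) (h (Fin.last s))

/-- The Gowers box sum `‖f‖_{U^s(ℤ)}^{2^s}`. -/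
noncomputable def gowersSum (s : ℕ) (f : ℤ → ℂ) : ℂ :=
  ∑' p : (Fin s → ℤ) × ℤ, gowersIterDiff s f p.1 p.2

/-- The Gowers norm `‖f‖_{U^s(ℤ)}`. -/
noncomputable def gowersNorm (s : ℕ) (f : ℤ → ℂ) : ℝ :=
  (gowersSum s f).re ^ ((1 : ℝ) / 2 ^ s)

/-- Restriction of `f` to the integer interval `[a, b]` (extended by `0`). -/
def intervalCutoff (a b : ℤ) (f : ℤ → ℂ) : ℤ → ℂ :=
  fun n => if a ≤ n ∧ n ≤ b then f n else 0

/-- The normalized Gowers norm `‖f‖_{U^s([N])}` on `{1, …, N}`. -/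
noncomputable def gowersNormOn (s : ℕ) (N : ℕ) (f : ℤ → ℂ) : ℝ :=
  gowersNorm s (intervalCutoff 1 N f) / gowersNorm s (intervalCutoff 1 N (fun _ => 1))

lemma Finset.sum_comp_add_right_of_support {F : ℤ → ℂ} {S J : Finset ℤ} {c : ℤ}
    (hJ : ∀ z ∉ J, F z = 0) (hS : ∀ z ∈ J, z - c ∈ S) :
    ∑ y ∈ S, F (y + c) = ∑ z ∈ J, F z := by
  have h₁ : ∑' y, F (y + c) = ∑ y ∈ S, F (y + c) := by
    refine tsum_eq_sum fun y hy => hJ _ fun h => hy ?_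
    simpa using hS _ h
  have h₂ : ∑' z, F z = ∑ z ∈ J, F z := tsum_eq_sum fun z hz => hJ z hz
  rw [← h₁, ← h₂]
  exact (Equiv.addRight c).tsum_eq F

lemma gowersDiff_eq_zero {w : ℤ → ℂ} {x : ℤ} (hx : w x = 0) (h : ℤ) : gowersDiff w h x = 0 := by
  simp [gowersDiff, hx]

lemma norm_gowersDiff_le_one {f : ℤ → ℂ} (hf : ∀ n, ‖f n‖ ≤ 1) (h n : ℤ) :
    ‖gowersDiff f h n‖ ≤ 1 := by
  simpa [gowersDiff] using mul_le_one₀ (hf n) (norm_nonneg _) (hf (n + h))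

lemma sq_norm_sum_eq_sum_gowersDiff {N : ℕ} {a : ℤ → ℂ}
    (ha : ∀ n ∉ Finset.Icc (1 : ℤ) N, a n = 0) :
    ((‖∑ n ∈ Finset.Icc (1 : ℤ) N, a n‖ ^ 2 : ℝ) : ℂ) =
      ∑ h ∈ Finset.Icc (-N : ℤ) N, ∑ n ∈ Finset.Icc (1 : ℤ) N, gowersDiff a h n := by
  rw [Finset.sum_comm]
  push_cast
  rw [← Complex.mul_conj', map_sum, Finset.sum_mul]
  refine Finset.sum_congr rfl fun n hn => ?_
  simp only [gowersDiff]
  rw [← Finset.mul_sum]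
  congr 1
  symm
  simp_rw [add_comm n]
  refine Finset.sum_comp_add_right_of_support (F := fun z => (starRingEnd ℂ) (a z)) ?_ ?_
  · intro z hz
    simp [ha z hz]
  · intro z hz
    simp only [Finset.mem_Icc] at hz hn ⊢
    omega

lemma gowersIterDiff_succ_cons (s : ℕ) (w : ℤ → ℂ) (k : ℤ) (h : Fin s → ℤ) :
    gowersIterDiff (s + 1) w (Fin.cons k h) = gowersIterDiff s (gowersDiff w k) h := by
  induction s with
  | zero => rfl
  | succ s ih =>
    have h₁ : (fun i : Fin (s + 1) => (Fin.cons k h : Fin (s + 2) → ℤ) i.castSucc) =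
        Fin.cons k (fun i : Fin s => h i.castSucc) := by
      funext i
      refine Fin.cases ?_ (fun j => ?_) i
      · simp
      · rw [← Fin.succ_castSucc]; simp
    have h₂ : (Fin.cons k h : Fin (s + 2) → ℤ) (Fin.last (s + 1)) = h (Fin.last s) := by
      rw [← Fin.succ_last]; simp
    change gowersDiff (gowersIterDiff (s + 1) w fun i => (Fin.cons k h : Fin (s + 2) → ℤ) i.castSucc)
        ((Fin.cons k h : Fin (s + 2) → ℤ) (Fin.last (s + 1))) =
      gowersDiff (gowersIterDiff s (gowersDiff w k) fun i => h i.castSucc) (h (Fin.last s))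
    rw [h₁, ih, h₂]

lemma mem_of_gowersIterDiff_ne_zero {N : ℕ} {w : ℤ → ℂ}
    (hw : ∀ n ∉ Finset.Icc (1 : ℤ) N, w n = 0) :
    ∀ (s : ℕ) (h : Fin s → ℤ) (x : ℤ), gowersIterDiff s w h x ≠ 0 →
      x ∈ Finset.Icc (1 : ℤ) N ∧ ∀ i, h i ∈ Finset.Icc (-N : ℤ) N := by
  intro s
  induction s with
  | zero =>
    intro h x hx
    exact ⟨by_contra fun hn => hx (hw x hn), fun i => i.elim0⟩
  | succ s ih =>
    intro h x hx
    rw [gowersIterDiff, gowersDiff] at hx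
    obtain ⟨hx₁, hh⟩ := ih _ _ (left_ne_zero_of_mul hx)
    obtain ⟨hx₂, -⟩ := ih _ _ (fun h0 => right_ne_zero_of_mul hx (by rw [h0, map_zero]))
    refine ⟨hx₁, fun i => ?_⟩
    refine Fin.lastCases ?_ (fun j => hh j) i
    simp only [Finset.mem_Icc] at hx₁ hx₂ ⊢
    omega

lemma gowersSum_zero {N : ℕ} {w : ℤ → ℂ} (hw : ∀ n ∉ Finset.Icc (1 : ℤ) N, w n = 0) :
    gowersSum 0 w = ∑ n ∈ Finset.Icc (1 : ℤ) N, w n := by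
  rw [gowersSum, ← (Equiv.uniqueProd ℤ (Fin 0 → ℤ)).symm.tsum_eq]
  exact tsum_eq_sum fun n hn => hw n hn

lemma gowersSum_succ {N : ℕ} {w : ℤ → ℂ} (hw : ∀ n ∉ Finset.Icc (1 : ℤ) N, w n = 0) (s : ℕ) :
    gowersSum (s + 1) w = ∑ h ∈ Finset.Icc (-N : ℤ) N, gowersSum s (gowersDiff w h) := by
  let e : ℤ × ((Fin s → ℤ) × ℤ) ≃ (Fin (s + 1) → ℤ) × ℤ :=
    (Equiv.prodAssoc _ _ _).symm.trans
      ((Fin.consEquiv (fun _ : Fin (s + 1) => ℤ)).prodCongr (Equiv.refl ℤ))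
  have he : ∀ q, gowersIterDiff (s + 1) w (e q).1 (e q).2 =
      gowersIterDiff s (gowersDiff w q.1) q.2.1 q.2.2 := fun q =>
    congrFun (gowersIterDiff_succ_cons s w q.1 q.2.1) q.2.2
  have hmem : ∀ q, gowersIterDiff (s + 1) w (e q).1 (e q).2 ≠ 0 →
      q.1 ∈ Finset.Icc (-N : ℤ) N ∧ q.2.1 ∈ Fintype.piFinset (fun _ => Finset.Icc (-N : ℤ) N) ∧
        q.2.2 ∈ Finset.Icc (1 : ℤ) N := by
    intro q hq
    obtain ⟨h₁, h₂⟩ := mem_of_gowersIterDiff_ne_zero hw _ _ _ hq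
    exact ⟨h₂ 0, Fintype.mem_piFinset.2 fun i => h₂ i.succ, h₁⟩
  have hsum : Summable fun q => gowersIterDiff (s + 1) w (e q).1 (e q).2 := by
    refine summable_of_ne_finset_zero (s := Finset.Icc (-N : ℤ) N ×ˢ
      (Fintype.piFinset (fun _ => Finset.Icc (-N : ℤ) N) ×ˢ Finset.Icc (1 : ℤ) N)) ?_
    intro q hq
    by_contra h0
    obtain ⟨h₁, h₂, h₃⟩ := hmem q h0
    exact hq (Finset.mem_product.2 ⟨h₁, Finset.mem_product.2 ⟨h₂, h₃⟩⟩)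
  rw [gowersSum, ← e.tsum_eq, hsum.tsum_prod]
  simp_rw [he]
  refine tsum_eq_sum fun h hh => ?_
  refine (tsum_congr fun q => ?_).trans tsum_zero
  by_contra h0
  exact hh (hmem (h, q) (by rwa [he])).1

lemma gowersSum_one {N : ℕ} {w : ℤ → ℂ} (hw : ∀ n ∉ Finset.Icc (1 : ℤ) N, w n = 0) :
    gowersSum 1 w = ((‖∑ n ∈ Finset.Icc (1 : ℤ) N, w n‖ ^ 2 : ℝ) : ℂ) := by
  rw [gowersSum_succ hw, sq_norm_sum_eq_sum_gowersDiff hw]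
  exact Finset.sum_congr rfl fun h _ => gowersSum_zero fun n hn => gowersDiff_eq_zero (hw n hn) h

lemma re_gowersSum_succ_nonneg {N : ℕ} (s : ℕ) : ∀ {w : ℤ → ℂ},
    (∀ n ∉ Finset.Icc (1 : ℤ) N, w n = 0) → 0 ≤ (gowersSum (s + 1) w).re := by
  induction s with
  | zero =>
    intro w hw
    rw [gowersSum_one hw, Complex.ofReal_re]
    positivity
  | succ s ih =>
    intro w hw
    rw [gowersSum_succ hw, Complex.re_sum]
    exact Finset.sum_nonneg fun h _ => ih fun n hn => gowersDiff_eq_zero (hw n hn) h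

lemma card_Icc_neg_self (N : ℕ) : ((Finset.Icc (-N : ℤ) N).card : ℝ) = 2 * N + 1 := by
  have : (Finset.Icc (-N : ℤ) N).card = 2 * N + 1 := by
    rw [Int.card_Icc]; omega
  rw [this]; push_cast; ring

lemma re_gowersSum_bounds_of_unitInterval {N : ℕ} (s : ℕ) : ∀ {u : ℤ → ℂ},
    (∀ n ∉ Finset.Icc (1 : ℤ) N, u n = 0) →
    (∀ n, ∃ r : ℝ, 0 ≤ r ∧ r ≤ 1 ∧ u n = r) →
    0 ≤ (gowersSum s u).re ∧ (gowersSum s u).re ≤ (2 * N + 1 : ℝ) ^ (s + 1) ∧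
      (1 ≤ N → u 1 = 1 → 1 ≤ (gowersSum s u).re) := by
  induction s with
  | zero =>
    intro u hu hr
    have h0 : ∀ n, 0 ≤ (u n).re := fun n => by
      obtain ⟨r, h₀, -, h⟩ := hr n
      rwa [h, Complex.ofReal_re]
    have h1 : ∀ n, (u n).re ≤ 1 := fun n => by
      obtain ⟨r, -, h₁, h⟩ := hr n
      rwa [h, Complex.ofReal_re]
    rw [gowersSum_zero hu, Complex.re_sum]
    refine ⟨Finset.sum_nonneg fun n _ => h0 n, ?_, fun hN hu1 => ?_⟩
    · refine (Finset.sum_le_sum fun n _ => h1 n).trans ?_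
      simp
      linarith [(N.cast_nonneg : (0 : ℝ) ≤ N)]
    · have := Finset.single_le_sum (f := fun n => (u n).re) (s := Finset.Icc (1 : ℤ) N)
        (fun n _ => h0 n) (a := 1) (by simp; omega)
      simpa [hu1] using this
  | succ s ih =>
    intro u hu hr
    have hd : ∀ h n, ∃ r : ℝ, 0 ≤ r ∧ r ≤ 1 ∧ gowersDiff u h n = r := fun h n => by
      obtain ⟨r, h₀, h₁, hr'⟩ := hr n
      obtain ⟨t, t₀, t₁, ht⟩ := hr (n + h)
      exact ⟨r * t, mul_nonneg h₀ t₀, mul_le_one₀ h₁ t₀ t₁, by simp [gowersDiff, hr', ht]⟩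
    have key := fun h => ih (u := gowersDiff u h) (fun n hn => gowersDiff_eq_zero (hu n hn) h) (hd h)
    rw [gowersSum_succ hu, Complex.re_sum]
    refine ⟨Finset.sum_nonneg fun h _ => (key h).1, ?_, fun hN hu1 => ?_⟩
    · refine (Finset.sum_le_sum fun h _ => (key h).2.1).trans (le_of_eq ?_)
      rw [Finset.sum_const, nsmul_eq_mul, card_Icc_neg_self]
      ring
    · refine ((key 0).2.2 hN (by simp [gowersDiff, hu1])).trans ?_
      exact Finset.single_le_sum (f := fun h => (gowersSum s (gowersDiff u h)).re)
        (fun h _ => (key h).1) (by simp)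

/-- The unnormalised weighted bilinear average. -/
noncomputable def bilinearSum (N : ℕ) (f g w : ℤ → ℂ) (x : ℤ) : ℂ :=
  ∑ n ∈ Finset.Icc (1 : ℤ) N, f (x - n) * g (x + n) * w n

lemma sq_norm_bilinearSum {N : ℕ} {f g w : ℤ → ℂ}
    (hw : ∀ n ∉ Finset.Icc (1 : ℤ) N, w n = 0) (x : ℤ) :
    ((‖bilinearSum N f g w x‖ ^ 2 : ℝ) : ℂ) = ∑ h ∈ Finset.Icc (-N : ℤ) N,
      bilinearSum N (gowersDiff f (-h)) (gowersDiff g h) (gowersDiff w h) x := by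
  rw [bilinearSum, sq_norm_sum_eq_sum_gowersDiff fun n hn => by rw [hw n hn, mul_zero]]
  refine Finset.sum_congr rfl fun h _ => Finset.sum_congr rfl fun n _ => ?_
  simp only [gowersDiff, map_mul]
  rw [show x - (n + h) = x - n + -h by ring, show x + (n + h) = x + n + h by ring]
  ring

lemma Finset.pow_sum_mul_card_le {ι : Type*} (S : Finset ι) (a : ι → ℝ) (ha : ∀ i ∈ S, 0 ≤ a i)
    {p : ℕ} (hp : 1 ≤ p) :
    (∑ i ∈ S, a i) ^ p * S.card ≤ (S.card : ℝ) ^ p * ∑ i ∈ S, a i ^ p := by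
  obtain ⟨q, rfl⟩ := Nat.exists_eq_add_of_le' hp
  rcases S.eq_empty_or_nonempty with rfl | hS
  · simp
  have hc : (0 : ℝ) < S.card := by exact_mod_cast hS.card_pos
  have := pow_sum_div_card_le_sum_pow ha q
  rw [div_le_iff₀ (by positivity)] at this
  calc _ ≤ ((∑ i ∈ S, a i ^ (q + 1)) * (S.card : ℝ) ^ q) * S.card := by gcongr
    _ = _ := by ring

lemma norm_sum_pow_four_le {N : ℕ} {lo hi : ℤ} {f g w : ℤ → ℂ}
    (hf : ∀ n, ‖f n‖ ≤ 1) (hg : ∀ n, ‖g n‖ ≤ 1)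
    (hfI : ∀ n ∉ Finset.Icc lo hi, f n = 0) (hgI : ∀ n ∉ Finset.Icc lo hi, g n = 0)
    (hw : ∀ n ∉ Finset.Icc (1 : ℤ) N, w n = 0) :
    ‖∑ x ∈ Finset.Icc (lo + 1) (hi + N), bilinearSum N f g w x‖ ^ 4 ≤
      (2 * N + 1) * (Finset.Icc lo hi).card ^ 4 * (gowersSum 2 w).re := by
  set I := Finset.Icc lo hi with hI
  set H := Finset.Icc (-N : ℤ) N with hH
  set P := Finset.Icc (1 : ℤ) N with hP
  set Y := Finset.Icc (lo - 2 * N) hi with hY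
  have hsub : I ⊆ Y := Finset.Icc_subset_Icc (by omega) le_rfl
  have h₁ : ∑ x ∈ Finset.Icc (lo + 1) (hi + N), bilinearSum N f g w x =
      ∑ y ∈ I, f y * ∑ n ∈ P, g (y + 2 * n) * w n := by
    simp only [bilinearSum, Finset.mul_sum]
    rw [Finset.sum_comm, Finset.sum_comm (s := I)]
    refine Finset.sum_congr rfl fun n hn => ?_
    rw [← Finset.sum_comp_add_right_of_support (F := fun y => f y * (g (y + 2 * n) * w n))
      (S := Finset.Icc (lo + 1) (hi + N)) (c := -n) (fun z hz => by simp [hfI z hz])]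
    · refine Finset.sum_congr rfl fun x _ => ?_
      rw [show x + -n + 2 * n = x + n by ring, ← sub_eq_add_neg, mul_assoc]
    · intro z hz
      simp only [hI, hP, Finset.mem_Icc] at hz hn ⊢
      omega
  have h₂ : ∀ y, ((‖∑ n ∈ P, g (y + 2 * n) * w n‖ ^ 2 : ℝ) : ℂ) =
      ∑ h ∈ H, ∑ n ∈ P, gowersDiff g (2 * h) (y + 2 * n) * gowersDiff w h n := fun y => by
    rw [sq_norm_sum_eq_sum_gowersDiff fun n hn => by rw [hw n hn, mul_zero]]
    refine Finset.sum_congr rfl fun h _ => Finset.sum_congr rfl fun n _ => ?_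
    simp only [gowersDiff, map_mul]
    rw [show y + 2 * (n + h) = y + 2 * n + 2 * h by ring]
    ring
  have h₃ : ((∑ y ∈ Y, ‖∑ n ∈ P, g (y + 2 * n) * w n‖ ^ 2 : ℝ) : ℂ) =
      ∑ h ∈ H, (∑ z ∈ I, gowersDiff g (2 * h) z) * ∑ n ∈ P, gowersDiff w h n := by
    rw [Complex.ofReal_sum]
    simp_rw [h₂]
    rw [Finset.sum_comm]
    refine Finset.sum_congr rfl fun h _ => ?_
    rw [Finset.sum_comm, Finset.mul_sum]
    refine Finset.sum_congr rfl fun n hn => ?_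
    rw [← Finset.sum_mul]
    congr 1
    refine Finset.sum_comp_add_right_of_support (fun z hz => gowersDiff_eq_zero (hgI z hz) _) ?_
    intro z hz
    simp only [hI, hP, hY, Finset.mem_Icc] at hz hn ⊢
    omega
  have h₄ : ∑ y ∈ Y, ‖∑ n ∈ P, g (y + 2 * n) * w n‖ ^ 2 ≤
      I.card * ∑ h ∈ H, ‖∑ n ∈ P, gowersDiff w h n‖ := by
    have hnn : 0 ≤ ∑ y ∈ Y, ‖∑ n ∈ P, g (y + 2 * n) * w n‖ ^ 2 := by positivity
    rw [← Complex.norm_of_nonneg hnn, h₃, Finset.mul_sum]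
    refine (norm_sum_le _ _).trans (Finset.sum_le_sum fun h _ => ?_)
    rw [norm_mul]
    gcongr
    refine (norm_sum_le _ _).trans ?_
    refine (Finset.sum_le_sum fun z _ => norm_gowersDiff_le_one hg _ z).trans ?_
    simp
  have h₅ : ‖∑ x ∈ Finset.Icc (lo + 1) (hi + N), bilinearSum N f g w x‖ ^ 2 ≤
      I.card ^ 2 * ∑ h ∈ H, ‖∑ n ∈ P, gowersDiff w h n‖ := by
    have hle : ‖∑ x ∈ Finset.Icc (lo + 1) (hi + N), bilinearSum N f g w x‖ ≤
        ∑ y ∈ I, ‖∑ n ∈ P, g (y + 2 * n) * w n‖ := by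
      rw [h₁]
      refine (norm_sum_le _ _).trans (Finset.sum_le_sum fun y _ => ?_)
      rw [norm_mul]
      exact mul_le_of_le_one_left (norm_nonneg _) (hf y)
    calc _ ≤ (∑ y ∈ I, ‖∑ n ∈ P, g (y + 2 * n) * w n‖) ^ 2 := by gcongr
      _ ≤ I.card * ∑ y ∈ I, ‖∑ n ∈ P, g (y + 2 * n) * w n‖ ^ 2 := sq_sum_le_card_mul_sum_sq
      _ ≤ I.card * ∑ y ∈ Y, ‖∑ n ∈ P, g (y + 2 * n) * w n‖ ^ 2 := by
        gcongr
      _ ≤ I.card * (I.card * ∑ h ∈ H, ‖∑ n ∈ P, gowersDiff w h n‖) := by gcongr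
      _ = _ := by ring
  have h₆ : (gowersSum 2 w).re = ∑ h ∈ H, ‖∑ n ∈ P, gowersDiff w h n‖ ^ 2 := by
    rw [gowersSum_succ hw, Complex.re_sum]
    refine Finset.sum_congr rfl fun h _ => ?_
    rw [gowersSum_one (fun n hn => gowersDiff_eq_zero (hw n hn) h), Complex.ofReal_re]
  calc _ = (‖∑ x ∈ Finset.Icc (lo + 1) (hi + N), bilinearSum N f g w x‖ ^ 2) ^ 2 := by ring
    _ ≤ (I.card ^ 2 * ∑ h ∈ H, ‖∑ n ∈ P, gowersDiff w h n‖) ^ 2 := by gcongr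
    _ = I.card ^ 4 * (∑ h ∈ H, ‖∑ n ∈ P, gowersDiff w h n‖) ^ 2 := by ring
    _ ≤ I.card ^ 4 * (H.card * ∑ h ∈ H, ‖∑ n ∈ P, gowersDiff w h n‖ ^ 2) := by
      gcongr
      exact sq_sum_le_card_mul_sum_sq
    _ = _ := by
      rw [h₆, card_Icc_neg_self]
      ring

lemma pow_four_mul_le_of_forall_gowersDiff {N s : ℕ} {A J : ℝ} {B : ℤ → ℝ} {w : ℤ → ℂ}
    (hw : ∀ n ∉ Finset.Icc (1 : ℤ) N, w n = 0) (hA : 0 ≤ A) (hB : ∀ h, 0 ≤ B h)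
    (hAB : A * (2 * N + 1) ≤ (2 * N + 1) ^ 2 ^ s * ∑ h ∈ Finset.Icc (-N : ℤ) N, B h)
    (hBG : ∀ h, B h ^ 4 * (2 * N + 1) ^ (s + 3) ≤
      (2 * N + 1) ^ (4 * 2 ^ s) * J ^ 4 * (gowersSum (s + 2) (gowersDiff w h)).re) :
    A ^ 4 * (2 * N + 1) ^ (s + 4) ≤
      (2 * N + 1) ^ (4 * 2 ^ (s + 1)) * J ^ 4 * (gowersSum (s + 3) w).re := by
  set M : ℝ := 2 * N + 1 with hM
  have hM0 : 0 < M := by positivity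
  set H := Finset.Icc (-N : ℤ) N with hH
  have hpow := Finset.pow_sum_mul_card_le H B (fun h _ => hB h) (p := 4) (by norm_num)
  rw [hH, card_Icc_neg_self, ← hM, ← hH] at hpow
  refine le_of_mul_le_mul_right ?_ (pow_pos hM0 4)
  calc A ^ 4 * M ^ (s + 4) * M ^ 4 = (A * M) ^ 4 * M ^ (s + 4) := by ring
    _ ≤ (M ^ 2 ^ s * ∑ h ∈ H, B h) ^ 4 * M ^ (s + 4) := by gcongr
    _ = M ^ (4 * 2 ^ s) * M ^ (s + 3) * ((∑ h ∈ H, B h) ^ 4 * M) := by ring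
    _ ≤ M ^ (4 * 2 ^ s) * M ^ (s + 3) * (M ^ 4 * ∑ h ∈ H, B h ^ 4) := by gcongr
    _ = M ^ (4 * 2 ^ s) * M ^ 4 * ∑ h ∈ H, B h ^ 4 * M ^ (s + 3) := by
      rw [← Finset.sum_mul]; ring
    _ ≤ M ^ (4 * 2 ^ s) * M ^ 4 * ∑ h ∈ H,
        M ^ (4 * 2 ^ s) * J ^ 4 * (gowersSum (s + 2) (gowersDiff w h)).re := by
      refine mul_le_mul_of_nonneg_left ?_ (by positivity)
      exact Finset.sum_le_sum fun h _ => hBG h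
    _ = _ := by
      rw [gowersSum_succ hw, Complex.re_sum, ← Finset.mul_sum]
      ring

lemma sum_norm_pow_pow_four_le {N : ℕ} {lo hi : ℤ} {s : ℕ} (hs : 1 ≤ s) : ∀ {f g w : ℤ → ℂ},
    (∀ n, ‖f n‖ ≤ 1) → (∀ n, ‖g n‖ ≤ 1) →
    (∀ n ∉ Finset.Icc lo hi, f n = 0) → (∀ n ∉ Finset.Icc lo hi, g n = 0) →
    (∀ n ∉ Finset.Icc (1 : ℤ) N, w n = 0) →
    (∑ x ∈ Finset.Icc (lo + 1) (hi + N), ‖bilinearSum N f g w x‖ ^ 2 ^ s) ^ 4 *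
        (2 * N + 1 : ℝ) ^ (s + 3) ≤
      (2 * N + 1) ^ (4 * 2 ^ s) * ((Finset.Icc lo hi).card : ℝ) ^ 4 *
        (gowersSum (s + 2) w).re := by
  induction s, hs using Nat.le_induction with
  | base =>
    intro f g w hf hg hfI hgI hw
    refine pow_four_mul_le_of_forall_gowersDiff (s := 0) hw (by positivity)
      (B := fun h => ‖∑ x ∈ Finset.Icc (lo + 1) (hi + N),
        bilinearSum N (gowersDiff f (-h)) (gowersDiff g h) (gowersDiff w h) x‖)
      (fun h => norm_nonneg _) ?_ fun h => ?_
    · simp only [pow_zero, pow_one]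
      rw [mul_comm]
      refine mul_le_mul_of_nonneg_left ?_ (by positivity)
      have hnn : 0 ≤ ∑ x ∈ Finset.Icc (lo + 1) (hi + N), ‖bilinearSum N f g w x‖ ^ 2 := by
        positivity
      rw [← Complex.norm_of_nonneg hnn, Complex.ofReal_sum]
      simp_rw [sq_norm_bilinearSum hw]
      rw [Finset.sum_comm]
      exact norm_sum_le _ _
    · have := norm_sum_pow_four_le (fun n => norm_gowersDiff_le_one hf (-h) n)
        (fun n => norm_gowersDiff_le_one hg h n)
        (fun n hn => gowersDiff_eq_zero (hfI n hn) (-h))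
        (fun n hn => gowersDiff_eq_zero (hgI n hn) h)
        (fun n hn => gowersDiff_eq_zero (hw n hn) h)
      calc _ ≤ _ := mul_le_mul_of_nonneg_right this (by positivity)
        _ = _ := by ring
  | succ s hs ih =>
    intro f g w hf hg hfI hgI hw
    refine pow_four_mul_le_of_forall_gowersDiff hw (by positivity)
      (B := fun h => ∑ x ∈ Finset.Icc (lo + 1) (hi + N),
        ‖bilinearSum N (gowersDiff f (-h)) (gowersDiff g h) (gowersDiff w h) x‖ ^ 2 ^ s)
      (fun h => by positivity) ?_ fun h => ?_
    · rw [Finset.sum_comm, Finset.sum_mul, Finset.mul_sum]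
      refine Finset.sum_le_sum fun x _ => ?_
      have := Finset.pow_sum_mul_card_le (Finset.Icc (-N : ℤ) N) (fun h => ‖bilinearSum N
        (gowersDiff f (-h)) (gowersDiff g h) (gowersDiff w h) x‖) (fun h _ => norm_nonneg _)
        (p := 2 ^ s) Nat.one_le_two_pow
      rw [card_Icc_neg_self] at this
      refine le_trans ?_ this
      rw [pow_succ' 2 s, pow_mul]
      gcongr
      rw [← Complex.norm_of_nonneg (sq_nonneg ‖bilinearSum N f g w x‖), sq_norm_bilinearSum hw]
      exact norm_sum_le _ _
    · exact ih (fun n => norm_gowersDiff_le_one hf (-h) n)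
        (fun n => norm_gowersDiff_le_one hg h n)
        (fun n hn => gowersDiff_eq_zero (hfI n hn) (-h))
        (fun n hn => gowersDiff_eq_zero (hgI n hn) h)
        (fun n hn => gowersDiff_eq_zero (hw n hn) h)

lemma intervalCutoff_eq_zero {a b n : ℤ} (hn : n ∉ Finset.Icc a b) (f : ℤ → ℂ) :
    intervalCutoff a b f n = 0 :=
  if_neg fun h => hn (Finset.mem_Icc.2 h)

lemma gowersNormOn_pow_pow_four {N : ℕ} (s : ℕ) (w : ℤ → ℂ) :
    (gowersNormOn (s + 2) N w ^ 2 ^ s) ^ 4 =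
      (gowersSum (s + 2) (intervalCutoff 1 N w)).re /
        (gowersSum (s + 2) (intervalCutoff 1 N fun _ => 1)).re := by
  have key : ∀ v : ℤ → ℂ, gowersNorm (s + 2) (intervalCutoff 1 N v) ^ 2 ^ (s + 2) =
      (gowersSum (s + 2) (intervalCutoff 1 N v)).re := fun v => by
    have h0 := re_gowersSum_succ_nonneg (N := N) (s + 1) (w := intervalCutoff 1 N v)
      fun n hn => intervalCutoff_eq_zero hn v
    rw [gowersNorm, ← Real.rpow_natCast, ← Real.rpow_mul h0]
    push_cast
    rw [one_div, inv_mul_cancel₀ (by positivity), Real.rpow_one]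
  rw [← pow_mul, show 2 ^ s * 4 = 2 ^ (s + 2) by ring, gowersNormOn, div_pow, key, key]

/-- **Gowers-norm control of weighted bilinear averages.** For every `s ≥ 1` and `C₀ ≥ 1`
there is a constant `C` such that: for every `N ≥ 1`, every interval `I = [lo, hi] ⊆ ℤ` with
`|I| ≤ C₀ N`, all `1`-bounded `f, g` supported on `I`, and every `w : ℤ → ℂ`,
`∑_{x ∈ ℤ} |(1/N) ∑_{n=1}^N f(x−n) g(x+n) w(n)|^{2^s} ≤ C ‖w‖_{U^{s+2}([N])}^{2^s} N`. -/
theorem bilinear_gowers_Us_estimate (s : ℕ) (hs : 1 ≤ s) (C₀ : ℝ) (hC₀ : 1 ≤ C₀) :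
    ∃ C : ℝ, ∀ N : ℕ, 1 ≤ N → ∀ lo hi : ℤ, ((hi - lo + 1 : ℤ) : ℝ) ≤ C₀ * N →
    ∀ f g w : ℤ → ℂ,
    (∀ n : ℤ, ‖f n‖ ≤ 1) → (∀ n : ℤ, ‖g n‖ ≤ 1) →
    (∀ n : ℤ, n ∉ Finset.Icc lo hi → f n = 0) →
    (∀ n : ℤ, n ∉ Finset.Icc lo hi → g n = 0) →
    ∑' x : ℤ, ‖((N : ℂ))⁻¹ * ∑ n ∈ Finset.Icc 1 N,
        f (x - (n : ℤ)) * g (x + (n : ℤ)) * w (n : ℤ)‖ ^ (2 ^ s) ≤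
      C * gowersNormOn (s + 2) N w ^ (2 ^ s) * (N : ℝ) := by
  refine ⟨3 ^ 2 ^ s * C₀, fun N hN lo hi hI f g w hf hg hfI hgI => ?_⟩
  set v := intervalCutoff 1 N w with hv
  have hv0 : ∀ n ∉ Finset.Icc (1 : ℤ) N, v n = 0 := fun n hn => intervalCutoff_eq_zero hn w
  have hN0 : (0 : ℝ) < N := by exact_mod_cast hN
  have hN1 : (1 : ℝ) ≤ N := by exact_mod_cast hN
  have hT : ∀ x : ℤ, ∑ n ∈ Finset.Icc 1 N, f (x - (n : ℤ)) * g (x + (n : ℤ)) * w (n : ℤ) =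
      bilinearSum N f g v x := fun x => by
    refine Finset.sum_bij (fun n _ => (n : ℤ)) ?_ ?_ ?_ ?_
    · intro n hn
      simp only [Finset.mem_Icc] at hn ⊢
      omega
    · intro a _ b _ hab
      exact_mod_cast hab
    · intro b hb
      simp only [Finset.mem_Icc] at hb
      exact ⟨b.toNat, by simp only [Finset.mem_Icc]; omega, by omega⟩
    · intro n hn
      simp only [Finset.mem_Icc] at hn
      rw [hv, intervalCutoff, if_pos (by omega)]
  have hsupp : ∀ x ∉ Finset.Icc (lo + 1) (hi + N), bilinearSum N f g v x = 0 := fun x hx => by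
    refine Finset.sum_eq_zero fun n hn => ?_
    rw [hfI (x - n), zero_mul, zero_mul]
    simp only [Finset.mem_Icc] at hx hn ⊢
    omega
  simp_rw [hT, norm_mul, mul_pow]
  rw [tsum_mul_left, tsum_eq_sum fun x hx => by
    rw [hsupp x hx, norm_zero, zero_pow (by positivity)]]
  have hmain := sum_norm_pow_pow_four_le hs hf hg hfI hgI hv0
  set A := ∑ x ∈ Finset.Icc (lo + 1) (hi + N), ‖bilinearSum N f g v x‖ ^ 2 ^ s
  have hcard : ((Finset.Icc lo hi).card : ℝ) ≤ C₀ * N := by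
    rw [Int.card_Icc]
    rcases le_total 0 (hi + 1 - lo) with h | h
    · have hc : ((hi + 1 - lo).toNat : ℝ) = ((hi - lo + 1 : ℤ) : ℝ) := by
        rw [← Int.cast_natCast, Int.toNat_of_nonneg h]
        push_cast
        ring
      rwa [hc]
    · rw [Int.toNat_of_nonpos h, Nat.cast_zero]
      positivity
  have hcard0 : (0 : ℝ) ≤ (Finset.Icc lo hi).card := Nat.cast_nonneg _
  generalize ((Finset.Icc lo hi).card : ℝ) = K at hmain hcard hcard0
  have hG := re_gowersSum_succ_nonneg (s + 1) hv0
  obtain ⟨-, hU, hL⟩ := re_gowersSum_bounds_of_unitInterval (N := N) (s + 2)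
    (u := intervalCutoff 1 N fun _ => 1) (fun n hn => intervalCutoff_eq_zero hn _)
    (fun n => by
      unfold intervalCutoff
      split_ifs
      · exact ⟨1, zero_le_one, le_rfl, by simp⟩
      · exact ⟨0, le_rfl, zero_le_one, by simp⟩)
  have hL1 := hL hN (if_pos (by omega))
  have hnorm := gowersNormOn_pow_pow_four (N := N) s w
  rw [← hv] at hnorm
  set G := (gowersSum (s + 2) v).re
  set G₁ := (gowersSum (s + 2) (intervalCutoff 1 N fun _ => 1)).re
  have hG₁ : 0 < G₁ := by linarith
  have hn0 : 0 ≤ gowersNormOn (s + 2) N w ^ 2 ^ s := by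
    obtain ⟨t, rfl⟩ := Nat.exists_eq_add_of_le' hs
    rw [pow_succ, pow_mul]
    positivity
  set R := gowersNormOn (s + 2) N w ^ 2 ^ s
  have hGR : G = R ^ 4 * G₁ := by
    rw [hnorm, div_mul_cancel₀ _ hG₁.ne']
  have hA : A ≤ (3 * N) ^ 2 ^ s * (C₀ * N) * R := by
    refine le_of_pow_le_pow_left₀ (n := 4) (by norm_num) (by positivity) ?_
    refine le_of_mul_le_mul_right (hmain.trans ?_) (by positivity : (0 : ℝ) < (2 * N + 1) ^ (s + 3))
    calc (2 * N + 1 : ℝ) ^ (4 * 2 ^ s) * K ^ 4 * G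
        ≤ (3 * N : ℝ) ^ (4 * 2 ^ s) * (C₀ * N) ^ 4 * (R ^ 4 * (2 * N + 1 : ℝ) ^ (s + 3)) := by
          rw [hGR]
          gcongr
          linarith
      _ = _ := by
          rw [pow_mul', mul_pow _ R, mul_pow _ (C₀ * N : ℝ)]
          generalize (3 * N : ℝ) ^ 2 ^ s = Q
          rw [mul_assoc _ (R ^ 4)]
  calc ‖(N : ℂ)⁻¹‖ ^ 2 ^ s * A ≤ ((N : ℝ)⁻¹) ^ 2 ^ s * ((3 * N) ^ 2 ^ s * (C₀ * N) * R) := by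
        rw [norm_inv, Complex.norm_natCast]
        gcongr
    _ = ((N : ℝ)⁻¹ * N) ^ 2 ^ s * (3 ^ 2 ^ s * C₀ * R * N) := by
        rw [mul_pow, mul_pow]; ring
    _ = _ := by rw [inv_mul_cancel₀ hN0.ne', one_pow, one_mul]
end

section
/- There is an absolute constant C such that the following holds. Let K₀ ≥ 1 be an integer, let M₀ = K₀·2^j for some integer j ≥ 0, and let Λ ⊆ {l/M₀ : 0 ≤ l < M₀}, viewed as a set of elements of ℝ/ℤ. Let Q ≥ 2, let i ≥ 0 be an integer, and let Γ_Q^{(i)} := {a/q : q ∈ ℕ, Q/2 < q ≤ Q, 2^i ∣ q, 2^{i+1} ∤ q, 0 ≤ a < q, gcd(a,q) = 1}, viewed in ℝ/ℤ. Then for all integers m, n with 1 ≤ |m| ≤ 10 and 1 ≤ |n| ≤ 10 and every ξ ∈ ℝ/ℤ: #{(θ, a/q) ∈ Λ × Γ_Q^{(i)} : m·θ + n·(a/q) = ξ in ℝ/ℤ} ≤ C·min{2^i·K₀, |Λ|}. -/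
open scoped Classical

/-- The dyadic slice `Γ_Q^{(i)} = {a/q : Q/2 < q ≤ Q, 2^i ∥ q, 0 ≤ a < q, (a,q) = 1}` of the
major-arc frequencies, as a finite set of real numbers in `[0,1)` (note
`Q/2 < q ↔ (Q : ℝ)/2 < q` for natural division). -/
noncomputable def gammaSlice (Q i : ℕ) : Finset ℝ :=
  ((Finset.Ioc (Q / 2) Q).filter fun q => 2 ^ i ∣ q ∧ ¬ 2 ^ (i + 1) ∣ q).biUnion fun q =>
    ((Finset.range q).filter fun a => Nat.Coprime a q).image fun a => (a : ℝ) / q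

/-- A finite subset of `[0,1)` whose differences all lie in `(1/N)ℤ` has at most `|N|` elements. -/
theorem card_le_of_mul_sub_int {S : Finset ℝ} {N : ℤ} (hN : N ≠ 0)
    (h01 : ∀ x ∈ S, 0 ≤ x ∧ x < 1)
    (h : ∀ x ∈ S, ∀ y ∈ S, ∃ k : ℤ, (N : ℝ) * (x - y) = k) : (S.card : ℤ) ≤ |N| := by
  have hpos : (0 : ℝ) < ((|N| : ℤ) : ℝ) := by exact_mod_cast abs_pos.mpr hN
  have h_abs : ∀ x ∈ S, ∀ y ∈ S, ∃ k : ℤ, ((|N| : ℤ) : ℝ) * (x - y) = k := by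
    intro x hx y hy
    obtain ⟨k, hk⟩ := h x hx y hy
    rcases abs_choice N with e | e
    · exact ⟨k, by rw [e, hk]⟩
    · exact ⟨-k, by rw [e]; push_cast; linarith⟩
  have hcard : S.card ≤ (Finset.Ico (0 : ℤ) |N|).card := by
    refine Finset.card_le_card_of_injOn (fun x => ⌊((|N| : ℤ) : ℝ) * x⌋) ?_ ?_
    · intro x hx
      obtain ⟨h0, h1⟩ := h01 x hx
      simp only [Finset.coe_Ico, Set.mem_Ico]
      refine ⟨Int.floor_nonneg.mpr (by positivity), Int.floor_lt.mpr ?_⟩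
      nlinarith
    · intro x hx y hy hxy
      obtain ⟨k, hk⟩ := h_abs x hx y hy
      have hlt := Int.abs_sub_lt_one_of_floor_eq_floor hxy
      rw [← mul_sub, hk] at hlt
      have hk0 : k = 0 := Int.abs_lt_one_iff.mp (by exact_mod_cast hlt)
      rw [hk0, Int.cast_zero, mul_eq_zero] at hk
      rcases hk with hk | hk
      · exact absurd hk hpos.ne'
      · linarith
  rw [Int.card_Ico, sub_zero] at hcard
  have := abs_nonneg N
  omega

/-- A real number with two coprime integer denominators is an integer. -/
theorem exists_int_eq_of_coprime_mul {a b : ℤ} (hab : IsCoprime a b) {z : ℝ}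
    (ha : ∃ k : ℤ, (a : ℝ) * z = k) (hb : ∃ k : ℤ, (b : ℝ) * z = k) : ∃ k : ℤ, z = k := by
  obtain ⟨u, v, huv⟩ := hab
  obtain ⟨k, hk⟩ := ha
  obtain ⟨l, hl⟩ := hb
  refine ⟨u * k + v * l, ?_⟩
  have huv' : (u : ℝ) * a + v * b = 1 := by exact_mod_cast huv
  push_cast
  rw [← hk, ← hl]
  linear_combination (-z) * huv'

theorem exists_odd_of_mem_gammaSlice {Q i : ℕ} {x : ℝ} (hx : x ∈ gammaSlice Q i) :
    (0 ≤ x ∧ x < 1) ∧ ∃ (u : ℕ) (a : ℤ), Odd u ∧ (2 : ℝ) ^ i * u * x = a := by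
  simp only [gammaSlice, Finset.mem_biUnion, Finset.mem_filter, Finset.mem_Ioc, Finset.mem_image,
    Finset.bind_def, Finset.pure_def, Finset.sup_eq_biUnion, Finset.mem_singleton,
    Finset.mem_range] at hx
  obtain ⟨q, ⟨⟨hq, -⟩, ⟨u, rfl⟩, hodd⟩, _, ⟨a, ⟨ha, -⟩, rfl⟩, rfl⟩ := hx
  have hq0 : (0 : ℝ) < ((2 ^ i * u : ℕ) : ℝ) := by exact_mod_cast (by omega : 0 < 2 ^ i * u)
  refine ⟨⟨by positivity, (div_lt_one hq0).mpr (by exact_mod_cast ha)⟩, u, a, ?_, ?_⟩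
  · rw [← Nat.not_even_iff_odd, even_iff_two_dvd]
    intro h2
    exact hodd (by rw [pow_succ]; exact mul_dvd_mul_left _ h2)
  · have : (2 : ℝ) ^ i * u = ((2 ^ i * u : ℕ) : ℝ) := by push_cast; ring
    rw [this, mul_div_cancel₀ _ hq0.ne']
    simp

theorem exists_int_of_sub_gammaSlice {Q i j : ℕ} {c : ℤ} {x y : ℝ} (hx : x ∈ gammaSlice Q i)
    (hy : y ∈ gammaSlice Q i) (h : ∃ k : ℤ, (c : ℝ) * 2 ^ j * (x - y) = k) :
    ∃ k : ℤ, ((2 ^ i * c : ℤ) : ℝ) * (x - y) = k := by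
  obtain ⟨-, u, a, hu, ha⟩ := exists_odd_of_mem_gammaSlice hx
  obtain ⟨-, v, b, hv, hb⟩ := exists_odd_of_mem_gammaSlice hy
  obtain ⟨k, hk⟩ := h
  have hcop : IsCoprime ((2 ^ j : ℕ) : ℤ) ((u * v : ℕ) : ℤ) :=
    Nat.isCoprime_iff_coprime.mpr
      (Nat.Coprime.pow_left j (Nat.coprime_two_left.mpr (hu.mul hv)))
  refine exists_int_eq_of_coprime_mul hcop ⟨2 ^ i * k, ?_⟩ ⟨c * (a * v - b * u), ?_⟩
  · push_cast
    linear_combination (2 : ℝ) ^ i * hk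
  · push_cast
    linear_combination (c : ℝ) * v * ha - (c : ℝ) * u * hb

/-- **Maximal multiplicity bound for sumsets `mΛ + nΓ_Q^{(i)}` in `ℝ/ℤ`.** There is an
absolute constant `C` such that: for all integers `K₀ ≥ 1`, `j ≥ 0`, `M₀ = K₀ 2^j`, every
`Λ ⊆ {l/M₀ : 0 ≤ l < M₀}`, every `Q ≥ 2`, `i ≥ 0`, all `m, n` with `1 ≤ |m|, |n| ≤ 10`, and
every `ξ`, the number of pairs `(θ, a/q) ∈ Λ × Γ_Q^{(i)}` with `mθ + n(a/q) = ξ` in `ℝ/ℤ`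
is at most `C · min(2^i K₀, |Λ|)`. -/
theorem sumset_multiplicity_bound :
    ∃ C : ℝ, ∀ K₀ : ℕ, 1 ≤ K₀ → ∀ j : ℕ, ∀ Λ : Finset ℝ,
    (∀ θ ∈ Λ, ∃ l : ℕ, l < K₀ * 2 ^ j ∧ θ = (l : ℝ) / (K₀ * 2 ^ j)) →
    ∀ Q : ℕ, 2 ≤ Q → ∀ i : ℕ, ∀ m n : ℤ,
    1 ≤ |m| → |m| ≤ 10 → 1 ≤ |n| → |n| ≤ 10 →
    ∀ ξ : ℝ,
    (((Λ ×ˢ gammaSlice Q i).filter fun p =>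
        ∃ k : ℤ, (m : ℝ) * p.1 + (n : ℝ) * p.2 = ξ + (k : ℝ)).card : ℝ) ≤
      C * min ((2 : ℝ) ^ i * (K₀ : ℝ)) (Λ.card : ℝ) := by
  refine ⟨100, ?_⟩
  intro K₀ hK j Λ hΛ Q _ i m n hm hm' hn hn' ξ
  set P := (Λ ×ˢ gammaSlice Q i).filter fun p =>
    ∃ k : ℤ, (m : ℝ) * p.1 + (n : ℝ) * p.2 = ξ + (k : ℝ) with hP
  have mem_P : ∀ p ∈ P, p.1 ∈ Λ ∧ p.2 ∈ gammaSlice Q i ∧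
      ∃ k : ℤ, (m : ℝ) * p.1 + (n : ℝ) * p.2 = ξ + (k : ℝ) := by
    intro p hp
    simpa [hP, and_assoc] using hp
  have hm0 : m ≠ 0 := by rintro rfl; simp at hm
  have hn0 : n ≠ 0 := by rintro rfl; simp at hn
  have hM : (0 : ℝ) < K₀ * 2 ^ j := by positivity
  have hΛ01 : ∀ θ ∈ Λ, 0 ≤ θ ∧ θ < 1 := by
    intro θ hθ
    obtain ⟨l, hl, rfl⟩ := hΛ θ hθ
    exact ⟨by positivity, (div_lt_one hM).mpr (by exact_mod_cast hl)⟩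
  have fiber_fst : ∀ θ ∈ P.image Prod.fst, (P.filter fun p => p.1 = θ).card ≤ 10 := by
    intro θ _
    have hcard : ((P.filter fun p => p.1 = θ).image Prod.snd).card =
        (P.filter fun p => p.1 = θ).card := by
      refine Finset.card_image_of_injOn ?_
      intro p hp p' hp' h
      simp only [Finset.coe_filter, Set.mem_ofPred_eq] at hp hp'
      exact Prod.ext (hp.2.trans hp'.2.symm) h
    have hle := card_le_of_mul_sub_int (S := (P.filter fun p => p.1 = θ).image Prod.snd) hn0
      (by
        intro x hx
        obtain ⟨p, hp, rfl⟩ := Finset.mem_image.mp hx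
        exact (exists_odd_of_mem_gammaSlice (mem_P p (Finset.mem_filter.mp hp).1).2.1).1)
      (by
        intro x hx y hy
        obtain ⟨p, hp, rfl⟩ := Finset.mem_image.mp hx
        obtain ⟨p', hp', rfl⟩ := Finset.mem_image.mp hy
        rw [Finset.mem_filter] at hp hp'
        obtain ⟨-, -, k, hk⟩ := mem_P p hp.1
        obtain ⟨-, -, l, hl⟩ := mem_P p' hp'.1
        rw [hp.2] at hk
        rw [hp'.2] at hl
        exact ⟨k - l, by push_cast; linear_combination hk - hl⟩)
    omega
  have fiber_snd : ∀ x ∈ P.image Prod.snd, (P.filter fun p => p.2 = x).card ≤ 10 := by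
    intro x _
    have hcard : ((P.filter fun p => p.2 = x).image Prod.fst).card =
        (P.filter fun p => p.2 = x).card := by
      refine Finset.card_image_of_injOn ?_
      intro p hp p' hp' h
      simp only [Finset.coe_filter, Set.mem_ofPred_eq] at hp hp'
      exact Prod.ext h (hp.2.trans hp'.2.symm)
    have hle := card_le_of_mul_sub_int (S := (P.filter fun p => p.2 = x).image Prod.fst) hm0
      (by
        intro θ hθ
        obtain ⟨p, hp, rfl⟩ := Finset.mem_image.mp hθ
        exact hΛ01 _ (mem_P p (Finset.mem_filter.mp hp).1).1)
      (by
        intro θ hθ φ hφ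
        obtain ⟨p, hp, rfl⟩ := Finset.mem_image.mp hθ
        obtain ⟨p', hp', rfl⟩ := Finset.mem_image.mp hφ
        rw [Finset.mem_filter] at hp hp'
        obtain ⟨-, -, k, hk⟩ := mem_P p hp.1
        obtain ⟨-, -, l, hl⟩ := mem_P p' hp'.1
        rw [hp.2] at hk
        rw [hp'.2] at hl
        exact ⟨k - l, by push_cast; linear_combination hk - hl⟩)
    omega
  have card_snd : ((P.image Prod.snd).card : ℤ) ≤ |2 ^ i * (n * K₀)| := by
    refine card_le_of_mul_sub_int (by positivity) ?_ ?_
    · intro x hx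
      obtain ⟨p, hp, rfl⟩ := Finset.mem_image.mp hx
      exact (exists_odd_of_mem_gammaSlice (mem_P p hp).2.1).1
    · intro x hx y hy
      obtain ⟨p, hp, rfl⟩ := Finset.mem_image.mp hx
      obtain ⟨p', hp', rfl⟩ := Finset.mem_image.mp hy
      obtain ⟨hθ, hx', k, hk⟩ := mem_P p hp
      obtain ⟨hφ, hy', l, hl⟩ := mem_P p' hp'
      obtain ⟨s, -, hs⟩ := hΛ _ hθ
      obtain ⟨t, -, ht⟩ := hΛ _ hφ
      rw [eq_div_iff hM.ne'] at hs ht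
      refine exists_int_of_sub_gammaSlice hx' hy' (j := j)
        ⟨K₀ * 2 ^ j * (k - l) - m * (s - t), ?_⟩
      push_cast
      linear_combination ((K₀ : ℝ) * 2 ^ j) * (hk - hl) - (m : ℝ) * (hs - ht)
  have bound_fst : P.card ≤ 10 * Λ.card :=
    (Finset.card_le_mul_card_image P 10 fiber_fst).trans
      (Nat.mul_le_mul_left 10 (Finset.card_le_card (by
        intro θ hθ
        obtain ⟨p, hp, rfl⟩ := Finset.mem_image.mp hθ
        exact (mem_P p hp).1)))
  have bound_snd : (P.card : ℤ) ≤ 100 * (2 ^ i * K₀) := by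
    have h1 : (P.card : ℤ) ≤ 10 * (P.image Prod.snd).card := by
      exact_mod_cast Finset.card_le_mul_card_image P 10 fiber_snd
    have h2 : |2 ^ i * (n * (K₀ : ℤ))| = |n| * (2 ^ i * K₀) := by
      rw [abs_mul, abs_mul, abs_of_nonneg (by positivity : (0 : ℤ) ≤ 2 ^ i), Nat.abs_cast]
      ring
    have h3 : |n| * (2 ^ i * (K₀ : ℤ)) ≤ 10 * (2 ^ i * K₀) := by gcongr
    linarith
  rw [mul_min_of_nonneg _ _ (by norm_num), le_min_iff]
  constructor
  · exact_mod_cast bound_snd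
  · have h : (P.card : ℝ) ≤ 10 * Λ.card := by exact_mod_cast bound_fst
    have : (0 : ℝ) ≤ Λ.card := by positivity
    linarith
end
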